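/- Let k and u₀ be real numbers and let z be a complex number with Im(z) > 0 and 2iz not an integer. Define ψ(u) = exp(−u/2)·W_{−k,iz}(exp(u)) for real u. If ψ(u₀) ≠ 0, then ψ is differentiable at u₀ and the principal Weyl–Titchmarsh m-function value m(u₀, z²) = ψ'(u₀)/ψ(u₀) satisfies m(u₀, z²) = −W_{1−k,iz}(exp(u₀)) / W_{−k,iz}(exp(u₀)) + ((1/2)·exp(u₀) + k − 1/2). -/

import Mathlib

/-- The Morse potential `V_k(u) = (1/4)·exp(2u) + k·exp(u)`. -/
noncomputable def morse (k u : ℝ) : ℝ := (1/4) * Real.exp (2*u) + k * Real.exp u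

/-- The Whittaker M-function `M_{κ,μ}(x)` for real `x > 0`, defined by its series. -/
noncomputable def whittakerM (κ μ : ℂ) (x : ℝ) : ℂ :=
  Complex.exp (-(x:ℂ)/2) * Complex.exp ((1/2 + μ) * (Real.log x : ℂ)) *
    ∑' j : ℕ, (Polynomial.eval (1/2 - κ + μ) (ascPochhammer ℂ j)) /
      ((Polynomial.eval (2*μ + 1) (ascPochhammer ℂ j)) * (Nat.factorial j : ℂ)) * (x:ℂ)^j

/-- The Whittaker W-function `W_{κ,μ}(x)` for real `x > 0` and `2μ` not an integer. -/
noncomputable def whittakerW (κ μ : ℂ) (x : ℝ) : ℂ :=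
  Complex.Gamma (-(2*μ)) / Complex.Gamma (1/2 - κ - μ) * whittakerM κ μ x +
  Complex.Gamma (2*μ) / Complex.Gamma (1/2 - κ + μ) * whittakerM κ (-μ) x

/-- Kummer coefficients. -/
noncomputable def kc (a b : ℂ) (j : ℕ) : ℂ :=
  (Polynomial.eval a (ascPochhammer ℂ j)) /
      ((Polynomial.eval b (ascPochhammer ℂ j)) * (Nat.factorial j : ℂ))

lemma poch_ne {b : ℂ} (hb : ∀ n : ℕ, b + n ≠ 0) (j : ℕ) :
    Polynomial.eval b (ascPochhammer ℂ j) ≠ 0 := by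
  induction j with
  | zero => simp
  | succ j ih => rw [ascPochhammer_succ_eval]; exact mul_ne_zero ih (hb j)

lemma poch_left (a : ℂ) (j : ℕ) : Polynomial.eval (a - 1) (ascPochhammer ℂ (j+1)) =
    (a - 1) * Polynomial.eval a (ascPochhammer ℂ j) := by
  rw [ascPochhammer_succ_left]
  simp [Polynomial.eval_comp]

lemma kc_succ {a b : ℂ} (hb : ∀ n : ℕ, b + n ≠ 0) (j : ℕ) :
    kc a b (j+1) = ((a + j) / ((b + j) * (j + 1))) * kc a b j := by
  unfold kc
  have h1 := poch_ne hb j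
  have h2 := hb j
  have h3 : ((j:ℂ)+1) ≠ 0 := by exact_mod_cast Nat.succ_ne_zero j
  have h4 : (Nat.factorial j : ℂ) ≠ 0 := by exact_mod_cast Nat.factorial_ne_zero j
  rw [ascPochhammer_succ_eval, ascPochhammer_succ_eval, Nat.factorial_succ]
  push_cast
  field_simp

lemma kc_rec {a b : ℂ} (hb : ∀ n : ℕ, b + n ≠ 0) (j : ℕ) :
    ((j:ℂ) + 1) * kc a b (j+1) + (b - a) * kc a b (j+1) - (b - a) * kc (a-1) b (j+1)
      = kc a b j := by
  unfold kc
  have h1 := poch_ne hb j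
  have h2 := hb j
  have h3 : ((j:ℂ)+1) ≠ 0 := by exact_mod_cast Nat.succ_ne_zero j
  have h4 : (Nat.factorial j : ℂ) ≠ 0 := by exact_mod_cast Nat.factorial_ne_zero j
  rw [poch_left, ascPochhammer_succ_eval, ascPochhammer_succ_eval, Nat.factorial_succ]
  push_cast
  field_simp
  ring

lemma kc_ratio (a b : ℂ) :
    Filter.Tendsto (fun j : ℕ => (a + j) / ((b + j) * ((j:ℂ) + 1))) Filter.atTop (nhds 0) := by
  have h1 : Filter.Tendsto (fun j : ℕ => (a + (1:ℂ) * j) / (b + (1:ℂ) * j)) Filter.atTop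
      (nhds (1 / 1)) := tendsto_add_mul_div_add_mul_atTop_nhds a b 1 one_ne_zero
  have h2 : Filter.Tendsto (fun j : ℕ => 1 / ((j:ℂ) + 1)) Filter.atTop (nhds 0) :=
    tendsto_one_div_add_atTop_nhds_zero_nat
  have := h1.mul h2
  simp only [mul_zero] at this
  refine this.congr fun j => ?_
  rw [one_mul, div_mul_div_comm, mul_one]

lemma kc_summable {a b : ℂ} (hb : ∀ n : ℕ, b + n ≠ 0) (R : ℝ) :
    Summable (fun j => ‖kc a b j‖ * R ^ j) := by
  apply summable_of_ratio_norm_eventually_le (r := 1/2) (by norm_num)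
  have h := ((kc_ratio a b).norm).mul_const |R|
  simp only [norm_zero, zero_mul] at h
  filter_upwards [h.eventually (gt_mem_nhds (show (0:ℝ) < 1/2 by norm_num))] with j hj
  rw [kc_succ hb]
  simp only [norm_mul, norm_norm, pow_succ, Real.norm_eq_abs R]
  have : 0 ≤ ‖kc a b j‖ * ‖R^j‖ := by positivity
  nlinarith

/-- Kummer function. -/
noncomputable def kF (a b y : ℂ) : ℂ := ∑' j : ℕ, kc a b j * y ^ j

lemma kF_summable {a b : ℂ} (hb : ∀ n : ℕ, b + n ≠ 0) (y : ℂ) :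
    Summable (fun j => kc a b j * y ^ j) := by
  refine Summable.of_norm_bounded (kc_summable (a := a) hb ‖y‖) fun j => ?_
  simp

lemma kc_bound (a b : ℂ) {R : ℝ} (hR : 1 ≤ R) {y : ℂ} (hy : ‖y‖ ≤ R) (j : ℕ) :
    ‖kc a b j * (j * y ^ (j-1))‖ ≤ ‖kc a b j‖ * (2 * R) ^ j := by
  rw [norm_mul, norm_mul, norm_pow, Complex.norm_natCast, mul_pow]
  have h1 : (j:ℝ) ≤ 2 ^ j := by exact_mod_cast (Nat.lt_two_pow_self).le
  have h2 : ‖y‖ ^ (j-1) ≤ R ^ j :=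
    (pow_le_pow_left₀ (norm_nonneg _) hy _).trans (pow_le_pow_right₀ hR (Nat.sub_le _ _))
  gcongr

lemma kF_deriv {a b : ℂ} (hb : ∀ n : ℕ, b + n ≠ 0) (y : ℂ) :
    HasDerivAt (kF a b) (∑' j : ℕ, kc a b j * (j * y ^ (j-1))) y := by
  have hR : (1:ℝ) ≤ ‖y‖ + 1 := by have := norm_nonneg y; linarith
  have hy : y ∈ Metric.ball (0:ℂ) (‖y‖ + 1) := by simp
  refine hasDerivAt_tsum_of_isPreconnected (t := Metric.ball (0:ℂ) (‖y‖ + 1))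
    (g := fun j y => kc a b j * y ^ j) (g' := fun j y => kc a b j * (j * y ^ (j-1)))
    (kc_summable (a := a) hb (2 * (‖y‖ + 1))) Metric.isOpen_ball
    (convex_ball _ _).isPreconnected ?_ ?_ hy (kF_summable hb y) hy
  · intro j w _
    exact (hasDerivAt_pow j w).const_mul _
  · intro j w hw
    refine kc_bound a b hR ?_ j
    simpa using (mem_ball_zero_iff.1 hw).le

lemma kF_deriv_eq {a b : ℂ} (hb : ∀ n : ℕ, b + n ≠ 0) (y : ℂ) :
    y * (∑' j : ℕ, kc a b j * (j * y ^ (j-1))) =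
      (y - (b - a)) * kF a b y + (b - a) * kF (a-1) b y := by
  have hR : (1:ℝ) ≤ ‖y‖ + 1 := by have := norm_nonneg y; linarith
  have s1 : Summable (fun j : ℕ => kc a b j * (j * y ^ (j-1))) :=
    Summable.of_norm_bounded (kc_summable (a := a) hb (2 * (‖y‖ + 1)))
      fun j => kc_bound a b hR (by linarith) j
  have s2 := kF_summable (a := a) hb y
  have s3 := kF_summable (a := a - 1) hb y
  have hs := ((s1.hasSum.mul_left y).add (s2.hasSum.mul_left (b-a))).sub
    (s3.hasSum.mul_left (b-a))
  have h5 := (hasSum_nat_add_iff' 1).2 hs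
  have h6 := h5.unique ((s2.hasSum.mul_left y).congr_fun ?_)
  · simp only [kF]
    simp [kc] at h6
    simp only [kc] at h6 ⊢
    linear_combination h6
  · intro j
    have := kc_rec (a := a) hb j
    rw [← this]
    simp only [Nat.add_sub_cancel]
    push_cast
    ring

lemma whittakerM_eq (κ μ : ℂ) (u : ℝ) : whittakerM κ μ (Real.exp u) =
    Complex.exp (-(Complex.exp u)/2) * Complex.exp ((1/2 + μ) * u) *
      kF (1/2 - κ + μ) (2*μ+1) (Complex.exp u) := by
  simp [whittakerM, kF, kc]

lemma whittakerM_deriv (κ μ : ℂ) (hb : ∀ n : ℕ, 2*μ+1 + n ≠ 0) (u : ℝ) :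
    HasDerivAt (fun u : ℝ => whittakerM κ μ (Real.exp u))
      ((Complex.exp u / 2 - κ) * whittakerM κ μ (Real.exp u) +
        (1/2 + κ + μ) * whittakerM (κ+1) μ (Real.exp u)) u := by
  simp only [whittakerM_eq]
  have e := Complex.hasDerivAt_exp (u:ℂ)
  have h1 : HasDerivAt (fun w : ℂ => Complex.exp (-(Complex.exp w)/2)) _ (u:ℂ) :=
    (e.neg.div_const 2).cexp
  have h2 : HasDerivAt (fun w : ℂ => Complex.exp ((1/2 + μ) * w)) _ (u:ℂ) :=
    ((hasDerivAt_id (u:ℂ)).const_mul (1/2+μ)).cexp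
  have h3 : HasDerivAt (fun w : ℂ => kF (1/2 - κ + μ) (2*μ+1) (Complex.exp w)) _ (u:ℂ) :=
    HasDerivAt.comp (u:ℂ) (kF_deriv (a := 1/2 - κ + μ) hb (Complex.exp u)) e
  have h := ((h1.mul h2).mul h3).comp_ofReal
  refine h.congr_deriv ?_
  have k := kF_deriv_eq (a := 1/2 - κ + μ) hb (Complex.exp u)
  rw [show 1/2 - (κ+1) + μ = 1/2 - κ + μ - 1 by ring]
  simp only [id, Pi.mul_apply, Pi.neg_apply]
  linear_combination (Complex.exp (-(Complex.exp u)/2) * Complex.exp ((1/2 + μ) * u)) * k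

lemma gamma_shift (c s : ℂ) : c / Complex.Gamma (s - 1) = (s - 1) * (c / Complex.Gamma s) := by
  have := Complex.one_div_Gamma_eq_self_mul_one_div_Gamma_add_one (s - 1)
  rw [sub_add_cancel] at this
  rw [div_eq_mul_inv, div_eq_mul_inv, this]
  ring

lemma whittakerW_deriv (κ μ : ℂ) (hb : ∀ n : ℤ, 2*μ ≠ n) (u : ℝ) :
    HasDerivAt (fun u : ℝ => whittakerW κ μ (Real.exp u))
      ((Complex.exp u / 2 - κ) * whittakerW κ μ (Real.exp u) -
        whittakerW (κ+1) μ (Real.exp u)) u := by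
  have b1 : ∀ n : ℕ, 2*μ+1 + n ≠ 0 := fun n h => hb (-(n+1)) (by
    push_cast; linear_combination h)
  have b2 : ∀ n : ℕ, 2*(-μ)+1 + n ≠ 0 := fun n h => hb (n+1) (by
    push_cast; linear_combination -h)
  unfold whittakerW
  refine (((whittakerM_deriv κ μ b1 u).const_mul _).add
    ((whittakerM_deriv κ (-μ) b2 u).const_mul _)).congr_deriv ?_
  rw [show 1/2 - (κ+1) - μ = (1/2 - κ - μ) - 1 by ring,
    show 1/2 - (κ+1) + μ = (1/2 - κ + μ) - 1 by ring, gamma_shift, gamma_shift]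
  ring

/-- The principal Weyl–Titchmarsh m-function of the Morse potential on `[u₀,∞)`:
`m(u₀, z²) = -W_{1-k,iz}(e^{u₀})/W_{-k,iz}(e^{u₀}) + ((1/2)e^{u₀} + k - 1/2)`. -/
theorem stmt_19 (k u₀ : ℝ) (z : ℂ) (hz : 0 < z.im)
    (hzi : ∀ n : ℤ, 2 * Complex.I * z ≠ (n:ℂ))
    (ψ : ℝ → ℂ)
    (hψ : ∀ u : ℝ, ψ u = Complex.exp (-(u:ℂ)/2) * whittakerW (-(k:ℂ)) (Complex.I * z) (Real.exp u))
    (h0 : ψ u₀ ≠ 0) :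
    DifferentiableAt ℝ ψ u₀ ∧
    deriv ψ u₀ / ψ u₀ =
      -(whittakerW (1 - (k:ℂ)) (Complex.I * z) (Real.exp u₀)) /
        whittakerW (-(k:ℂ)) (Complex.I * z) (Real.exp u₀) +
      (((1/2) * Real.exp u₀ + k - 1/2 : ℝ) : ℂ) := by
  have hb : ∀ n : ℤ, 2 * (Complex.I * z) ≠ n := fun n h => hzi n (by rw [← h]; ring)
  have hW := whittakerW_deriv (-(k:ℂ)) (Complex.I * z) hb u₀
  have hE : HasDerivAt (fun u : ℝ => Complex.exp (-(u:ℂ)/2)) _ u₀ :=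
    (((hasDerivAt_id (u₀:ℂ)).neg.div_const 2).cexp).comp_ofReal
  have hd := hE.mul hW
  have hf : ψ = (fun u : ℝ => Complex.exp (-(u:ℂ)/2)) *
      (fun u : ℝ => whittakerW (-(k:ℂ)) (Complex.I * z) (Real.exp u)) := funext hψ
  rw [← hf] at hd
  refine ⟨hd.differentiableAt, ?_⟩
  have h1 := h0
  rw [hψ] at h1
  have hw := right_ne_zero_of_mul h1
  have he := left_ne_zero_of_mul h1
  rw [hd.deriv, hψ, show -(k:ℂ) + 1 = 1 - k by ring]
  simp only [id, Pi.neg_apply]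
  push_cast at hw ⊢
  field_simp
  ring
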